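/- arXiv:2308.06927 — 5 statements merged into one kernel-verified Lean document; each statement's English description precedes it below -/
import Mathlib

section
/- Let 𝒳 be a countable set, μ : 𝒳 → ℝ a probability measure that is strictly positive everywhere, and π : 𝒳 → ℝ a measure that is strictly positive everywhere. Let X be a random variable with law μ, and let Y be a random variable on 𝒳 with Pr(Y = y | X = x) = P(y,x), where P is a stochastic matrix satisfying Pπ = π. Define the stochastic entropy production of the transition as ΔĤ_π := Ĥ_π(Y, Pμ) − Ĥ_π(X, μ). Then E[ 2^{−ΔĤ_π} ] = 1. -/
/-- A nonzero sum can only come from a summable family. -/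
theorem summable_of_tsum_eq_of_pos {α : Type*} {f : α → ℝ} {a : ℝ}
    (h : ∑' x, f x = a) (ha : 0 < a) : Summable f := by
  by_contra hf
  rw [tsum_eq_zero_of_not_summable hf] at h
  exact ha.ne h

/-- Tonelli's theorem for nonnegative double series of reals. -/
theorem summable_uncurry_and_tsum_comm_of_nonneg {α β : Type*} {f : α → β → ℝ} {g : α → ℝ}
    (hf : ∀ a b, 0 ≤ f a b) (hrow : ∀ a, HasSum (f a) (g a)) (hg : Summable g) :
    Summable (fun b => ∑' a, f a b) ∧ ∑' b, ∑' a, f a b = ∑' a, g a := by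
  have hs : Summable (Function.uncurry f) := by
    refine (summable_prod_of_nonneg (f := Function.uncurry f) (fun p => hf p.1 p.2)).2 ⟨
      fun a => (hrow a).summable, ?_⟩
    simpa only [Function.uncurry_apply_pair, (hrow _).tsum_eq] using hg
  refine ⟨hs.prod_symm.prod, ?_⟩
  rw [hs.tsum_comm]
  simp only [(hrow _).tsum_eq]

/-- The exponential of the entropy difference is a ratio of likelihoods. -/
theorem two_rpow_neg_logb_div_sub_logb_div {a b c d : ℝ}
    (ha : 0 < a) (hb : 0 < b) (hc : 0 < c) (hd : 0 < d) :
    (2 : ℝ) ^ (-(Real.logb 2 (a / b) - Real.logb 2 (c / d))) = c / d / (a / b) := by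
  rw [neg_sub, ← Real.logb_div (by positivity) (by positivity)]
  exact Real.rpow_logb (by norm_num) (by norm_num) (by positivity)

/-- Let `𝒳` be countable, `μ` an everywhere-positive probability measure on
`𝒳`, `π` an everywhere-positive measure, and `P` a stochastic matrix with `Pπ = π`. If
`X ∼ μ` and `Y | X = x ∼ P(·,x)`, the stochastic entropy production of the transition is
`ΔĤ_π := Ĥ_π(Y, Pμ) − Ĥ_π(X, μ)`, where `Ĥ_π(x,ρ) := log₂(π(x)/ρ(x))` and
`Pμ(y) := ∑_x P(y,x)μ(x)`. Then `E[ 2^{−ΔĤ_π} ] = 1`, the expectation being over the joint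
law `(x,y) ↦ μ(x)·P(y,x)`. -/
theorem integral_fluctuation_theorem_stochastic_entropy
    {𝒳 : Type*} [Countable 𝒳]
    (π μ : 𝒳 → ℝ) (P : 𝒳 → 𝒳 → ℝ)
    (hπpos : ∀ x, 0 < π x)
    (hμpos : ∀ x, 0 < μ x)
    (hμprob : ∑' x : 𝒳, μ x = 1)
    (hPnn : ∀ x y, 0 ≤ P y x)
    (hPstoch : ∀ x, ∑' y : 𝒳, P y x = 1)
    (hPπ : ∀ y, ∑' x : 𝒳, P y x * π x = π y) :
    ∑' x : 𝒳, ∑' y : 𝒳, μ x * P y x *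
      (2 : ℝ) ^ (-(Real.logb 2 (π y / (∑' x' : 𝒳, P y x' * μ x'))
        - Real.logb 2 (π x / μ x))) = 1 := by
  have hPs (x : 𝒳) : Summable (fun y => P y x) := summable_of_tsum_eq_of_pos (hPstoch x) one_pos
  have hμs : Summable μ := summable_of_tsum_eq_of_pos hμprob one_pos
  have hP1 (x y : 𝒳) : P y x ≤ 1 :=
    hPstoch x ▸ (hPs x).le_tsum y fun z _ => hPnn x z
  have hqs (y : 𝒳) : Summable (fun x => P y x * μ x) :=
    hμs.of_nonneg_of_le (fun x => mul_nonneg (hPnn x y) (hμpos x).le)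
      fun x => mul_le_of_le_one_left (hμpos x).le (hP1 x y)
  have hqpos (y : 𝒳) : 0 < ∑' x, P y x * μ x := by
    obtain ⟨x, hx⟩ : ∃ x, P y x ≠ 0 := by
      by_contra! h
      have := hPπ y
      simp only [h, zero_mul, tsum_zero] at this
      exact (hπpos y).ne this
    exact (hqs y).tsum_pos (fun z => mul_nonneg (hPnn z y) (hμpos z).le) x
      (mul_pos ((hPnn x y).lt_of_ne' hx) (hμpos x))
  obtain ⟨hq, hq1⟩ := summable_uncurry_and_tsum_comm_of_nonneg
    (f := fun x y => P y x * μ x) (g := μ)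
    (fun x y => mul_nonneg (hPnn x y) (hμpos x).le)
    (fun x => by simpa [hPstoch x] using (hPs x).hasSum.mul_right (μ x)) hμs
  rw [← hμprob, ← hq1]
  refine Eq.trans ?_ (summable_uncurry_and_tsum_comm_of_nonneg
    (f := fun y x => P y x * π x * ((∑' x', P y x' * μ x') / π y))
    (g := fun y => ∑' x, P y x * μ x)
    (fun y x => mul_nonneg (mul_nonneg (hPnn x y) (hπpos x).le)
      (div_nonneg (hqpos y).le (hπpos y).le)) (fun y => ?_) hq).2
  · refine tsum_congr fun x => tsum_congr fun y => ?_
    rw [two_rpow_neg_logb_div_sub_logb_div (hπpos y) (hqpos y) (hπpos x) (hμpos x)]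
    have := (hμpos x).ne'
    field_simp
  · have h := (summable_of_tsum_eq_of_pos (hPπ y) (hπpos y)).hasSum.mul_right
      ((∑' x', P y x' * μ x') / π y)
    rwa [hPπ y, mul_div_cancel₀ _ (hπpos y).ne'] at h
end

section
/- Let 𝒳 be a countable set, π : 𝒳 → ℝ a measure that is strictly positive everywhere, μ : 𝒳 → ℝ a probability measure that is strictly positive everywhere, and P : 𝒳 × 𝒳 → ℝ a stochastic matrix with Pπ = π. If the generalized Gibbs-Shannon entropies H_π(μ) := ∑_{x∈𝒳} μ(x) log₂(π(x)/μ(x)) and H_π(Pμ) are well-defined (the sums converge absolutely), then the Gibbs-Shannon entropy production is nonnegative: H_π(Pμ) ≥ H_π(μ). -/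
/-- A matrix with nonnegative entries and unit column sums maps summable functions to families
that are summable over all index pairs. -/
theorem summable_stochastic_mul {α : Type*} {P : α → α → ℝ}
    (hPnn : ∀ x y, 0 ≤ P y x) (hPstoch : ∀ x, HasSum (fun y => P y x) 1)
    {h : α → ℝ} (hh : Summable h) :
    Summable fun p : α × α => P p.2 p.1 * h p.1 := by
  apply Summable.of_abs
  rw [summable_prod_of_nonneg (fun p => abs_nonneg _)]
  have key : ∀ x, HasSum (fun y => |P y x * h x|) |h x| := fun x => by
    simpa [abs_mul, abs_of_nonneg (hPnn _ _)] using (hPstoch x).mul_right |h x|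
  refine ⟨fun x => (key x).summable, ?_⟩
  simpa only [(key _).tsum_eq] using hh.abs

/-- The tangent-line inequality for `t ↦ t * log t` at `b / c`, scaled by `p` and in base two. -/
theorem mul_logb_div_le {q m p b c : ℝ} (hq : 0 < q) (hm : 0 < m) (hp : 0 ≤ p)
    (hb : 0 < b) (hc : 0 < c) :
    p * (m * Real.logb 2 (q / m)) ≤
      p * m * Real.logb 2 (c / b) + (p * q * (b / c) - p * m) / Real.log 2 := by
  have hL : 0 < Real.log 2 := Real.log_pos one_lt_two
  have h := Real.log_le_sub_one_of_pos (x := q / m * (b / c)) (by positivity)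
  have hlog : Real.log (q / m * (b / c)) = Real.log (q / m) - Real.log (c / b) := by
    rw [Real.log_mul (by positivity) (by positivity), ← inv_div c b, Real.log_inv]
    ring
  rw [hlog] at h
  have h2 := mul_le_mul_of_nonneg_left h (mul_nonneg hp hm.le)
  have h3 : p * m * (q / m * (b / c) - 1) = p * q * (b / c) - p * m := by
    field_simp
  rw [h3] at h2
  have h4 := div_le_div_of_nonneg_right h2 hL.le
  simp only [Real.logb]
  have h5 : p * m * (Real.log (q / m) - Real.log (c / b)) / Real.log 2 =
      p * (m * (Real.log (q / m) / Real.log 2)) -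
        p * m * (Real.log (c / b) / Real.log 2) := by ring
  linarith

/-- Let `𝒳` be countable, `π` an everywhere-positive measure,
`μ` an everywhere-positive probability measure, and `P` a stochastic matrix with `Pπ = π`.
If the generalized Gibbs-Shannon entropies
`H_π(μ) := ∑_x μ(x) log₂(π(x)/μ(x))` and `H_π(Pμ)` are well-defined (the sums converge
absolutely, which for real-valued `tsum` is the hypothesis `Summable`), then the
Gibbs-Shannon entropy production is nonnegative: `H_π(Pμ) ≥ H_π(μ)`. -/
theorem gibbs_shannon_entropy_production_nonneg
    {𝒳 : Type*} [Countable 𝒳]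
    (π μ : 𝒳 → ℝ) (P : 𝒳 → 𝒳 → ℝ)
    (hπpos : ∀ x, 0 < π x)
    (hμpos : ∀ x, 0 < μ x)
    (hμprob : ∑' x : 𝒳, μ x = 1)
    (hPnn : ∀ x y, 0 ≤ P y x)
    (hPstoch : ∀ x, ∑' y : 𝒳, P y x = 1)
    (hPπ : ∀ y, ∑' x : 𝒳, P y x * π x = π y)
    (hHμ : Summable fun x : 𝒳 => μ x * Real.logb 2 (π x / μ x))
    (hHPμ : Summable fun y : 𝒳 =>
      (∑' x : 𝒳, P y x * μ x) * Real.logb 2 (π y / (∑' x : 𝒳, P y x * μ x))) :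
    ∑' y : 𝒳, (∑' x : 𝒳, P y x * μ x) * Real.logb 2 (π y / (∑' x : 𝒳, P y x * μ x)) ≥
      ∑' x : 𝒳, μ x * Real.logb 2 (π x / μ x) := by
  have hasSum_of {f : 𝒳 → ℝ} {a : ℝ} (ha : a ≠ 0) (h : ∑' x, f x = a) : HasSum f a := by
    have hs : Summable f := by
      by_contra hf
      exact ha (h.symm.trans (tsum_eq_zero_of_not_summable hf))
    exact h ▸ hs.hasSum
  have hP : ∀ x, HasSum (fun y => P y x) 1 := fun x => hasSum_of one_ne_zero (hPstoch x)
  have hPπs : ∀ y, HasSum (fun x => P y x * π x) (π y) := fun y =>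
    hasSum_of (hπpos y).ne' (hPπ y)
  have hμs : Summable μ := (hasSum_of one_ne_zero hμprob).summable
  have hPμs : ∀ y, Summable fun x => P y x * μ x :=
    (summable_stochastic_mul hPnn hP hμs).prod_symm.prod_factor
  have hν : ∀ y, 0 < ∑' x, P y x * μ x := by
    intro y
    obtain ⟨x, hx⟩ : ∃ x, P y x ≠ 0 := by
      by_contra! h
      have := hPπ y
      simp only [h, zero_mul, tsum_zero] at this
      exact (hπpos y).ne this
    exact (hPμs y).tsum_pos (fun z => mul_nonneg (hPnn z y) (hμpos z).le) x
      (mul_pos ((hPnn x y).lt_of_ne' hx) (hμpos x))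
  have hF := summable_stochastic_mul hPnn hP hHμ
  have hF' := hF.prod_symm
  have hrow : ∀ y, ∑' x, P y x * (μ x * Real.logb 2 (π x / μ x)) ≤
      (∑' x, P y x * μ x) * Real.logb 2 (π y / ∑' x, P y x * μ x) := by
    intro y
    have hsum := ((hPμs y).hasSum.mul_right (Real.logb 2 (π y / ∑' x, P y x * μ x))).add
      ((((hPπs y).mul_right ((∑' x, P y x * μ x) / π y)).sub
        (hPμs y).hasSum).div_const (Real.log 2))
    rw [mul_div_cancel₀ _ (hπpos y).ne', sub_self, zero_div, add_zero] at hsum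
    exact hasSum_le
      (fun x => mul_logb_div_le (hπpos x) (hμpos x) (hPnn x y) (hν y) (hπpos y))
      (hF'.prod_factor y).hasSum hsum
  calc ∑' x, μ x * Real.logb 2 (π x / μ x)
      = ∑' x, ∑' y, P y x * (μ x * Real.logb 2 (π x / μ x)) := by
        simp only [tsum_mul_right, hPstoch, one_mul]
    _ = ∑' y, ∑' x, P y x * (μ x * Real.logb 2 (π x / μ x)) := hF'.tsum_comm
    _ ≤ _ := hF'.prod.tsum_le_tsum hrow hHPμ
end

section
/- Let m > 1 be an integer, let 𝒳 be a finite set equipped with a linear order <, and let P : 𝒳 × 𝒳 → ℝ be a doubly stochastic matrix (all entries nonnegative, all rows and all columns sum to 1) such that m·P(y,x) is a nonnegative integer for all x, y ∈ 𝒳. Define T on 𝒳 × ℤ_m by: for all x, y ∈ 𝒳 and each integer i with 0 ≤ i < m·P(y,x), T( x, i + m·∑_{z<y} P(z,x) ) := ( y, i + m·∑_{z<x} P(y,z) ). Then T is a well-defined bijection of 𝒳 × ℤ_m: every element of 𝒳 × ℤ_m is in the domain of exactly one such assignment, and the resulting map is a bijection. -/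
open Finset

theorem sum_filter_lt_add_le_sum_filter_lt {α : Type*} [Fintype α] [LinearOrder α]
    (f : α → ℕ) {a b : α} (hab : a < b) :
    ∑ z ∈ univ.filter (· < a), f z + f a ≤ ∑ z ∈ univ.filter (· < b), f z := by
  rw [add_comm, ← sum_insert (by simp)]
  refine sum_le_sum_of_subset fun z hz => ?_
  simp only [mem_insert, mem_filter, mem_univ, true_and] at hz ⊢
  rcases hz with rfl | hz
  · exact hab
  · exact hz.trans hab

/-- A nonempty initial segment without its greatest element `b` consists of the elements
below `b`. -/
theorem exists_sum_eq_sum_filter_lt_add {α : Type*} [Fintype α] [LinearOrder α]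
    (f : α → ℕ) {s : Finset α} (hs : s.Nonempty) (hlow : IsLowerSet (s : Set α)) :
    ∃ b ∈ s, ∑ z ∈ s, f z = ∑ z ∈ univ.filter (· < b), f z + f b := by
  refine ⟨s.max' hs, s.max'_mem hs, ?_⟩
  rw [add_comm, ← sum_insert (by simp)]
  congr 1
  ext z
  simp only [mem_insert, mem_filter, mem_univ, true_and]
  refine ⟨fun hz => (s.le_max' z hz).eq_or_lt, fun hz => ?_⟩
  exact hlow (le_of_eq_or_lt hz) (s.max'_mem hs)

/-- The intervals between consecutive partial sums of `f` partition `[0, ∑ f)`. -/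
theorem existsUnique_partial_sum_interval {α : Type*} [Fintype α] [LinearOrder α]
    (f : α → ℕ) {k : ℕ} (hk : k < ∑ z, f z) :
    ∃! a, ∑ z ∈ univ.filter (· < a), f z ≤ k ∧
      k < ∑ z ∈ univ.filter (· < a), f z + f a := by
  have hne : (univ.filter fun a => k < ∑ z ∈ univ.filter (· < a), f z + f a).Nonempty := by
    have hu : (univ : Finset α).Nonempty := by
      by_contra h
      simp [not_nonempty_iff_eq_empty.mp h] at hk
    obtain ⟨b, -, hb⟩ := exists_sum_eq_sum_filter_lt_add f hu (by simp [isLowerSet_univ])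
    exact ⟨b, by simpa [← hb] using hk⟩
  obtain ⟨a, ha⟩ := exists_minimal hne
  have hka := (mem_filter.mp ha.prop).2
  refine ⟨a, ⟨?_, hka⟩, ?_⟩
  · by_contra! h
    have hs : (univ.filter (· < a)).Nonempty := by
      by_contra hs
      simp [not_nonempty_iff_eq_empty.mp hs] at h
    obtain ⟨b, hb, hsum⟩ := exists_sum_eq_sum_filter_lt_add f hs
      (fun c d hdc hc => by
        simpa using hdc.trans_lt (mem_filter.mp hc).2)
    have hba : b < a := (mem_filter.mp hb).2
    rw [hsum] at h
    exact ha.not_lt (by simpa using h) hba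
  · rintro b ⟨hb, hkb⟩
    rcases lt_trichotomy b a with h | h | h
    · exact absurd h (ha.not_lt (mem_filter.mpr ⟨mem_univ b, hkb⟩))
    · exact h
    · have := sum_filter_lt_add_le_sum_filter_lt f h
      omega

theorem existsUnique_multibaker_image {𝒳 : Type*} [Fintype 𝒳] [LinearOrder 𝒳] {m : ℕ}
    (N : 𝒳 → 𝒳 → ℕ) (hcol : ∀ x, ∑ y, N y x = m) (hrow : ∀ y, ∑ x, N y x = m)
    (p : 𝒳 × Fin m) :
    ∃! q : 𝒳 × Fin m, ∃ i : ℕ, i < N q.1 p.1 ∧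
      (p.2 : ℕ) = i + ∑ z ∈ univ.filter (· < q.1), N z p.1 ∧
      (q.2 : ℕ) = i + ∑ z ∈ univ.filter (· < p.1), N q.1 z := by
  obtain ⟨x, k⟩ := p
  obtain ⟨y, ⟨hle, hlt⟩, huniq⟩ :=
    existsUnique_partial_sum_interval (fun y => N y x) (k := k) (by rw [hcol]; exact k.isLt)
  have hbound : ∑ z ∈ univ.filter (· < x), N y z + N y x ≤ m := by
    rw [← hrow y, add_comm, ← sum_insert (by simp)]
    exact sum_le_sum_of_subset (subset_univ _)
  refine ⟨⟨y, ⟨k - ∑ z ∈ univ.filter (· < y), N z x + ∑ z ∈ univ.filter (· < x), N y z,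
    by omega⟩⟩, ⟨k - ∑ z ∈ univ.filter (· < y), N z x, ?_, ?_, rfl⟩, ?_⟩
  · dsimp only
    omega
  · dsimp only
    omega
  · rintro ⟨y', l⟩ ⟨i, hi, hk, hl⟩
    dsimp only at hi hk hl
    obtain rfl : y' = y := huniq y' ⟨by omega, by omega⟩
    refine Prod.ext rfl (Fin.ext ?_)
    dsimp only
    omega

theorem exists_equiv_of_existsUnique {α β : Type*} {R : α → β → Prop}
    (hleft : ∀ a, ∃! b, R a b) (hright : ∀ b, ∃! a, R a b) :
    ∃ T : α ≃ β, ∀ a b, R a b ↔ T a = b := by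
  choose f hf hf' using hleft
  choose g hg hg' using hright
  refine ⟨⟨f, g, fun a => (hg' _ a (hf a)).symm, fun b => (hf' _ b (hg b)).symm⟩, fun a b =>
    ⟨fun h => (hf' a b h).symm, ?_⟩⟩
  rintro rfl
  exact hf a

/-- Let `m > 1`, let `𝒳` be a finite linearly ordered set, and let
`P : 𝒳 × 𝒳 → ℝ` be a doubly stochastic matrix such that `m·P(y,x)` is a nonnegative
integer `N(y,x)` for all `x, y`. The multibaker assignments
`T( x, i + m·∑_{z<y} P(z,x) ) := ( y, i + m·∑_{z<x} P(y,z) )` for `0 ≤ i < m·P(y,x)`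
give a well-defined bijection of `𝒳 × ℤ_m`: every element of `𝒳 × ℤ_m` is in the domain
of exactly one assignment, and the resulting map is a bijection. -/
theorem multibaker_bijection_well_defined
    {𝒳 : Type*} [Fintype 𝒳] [LinearOrder 𝒳]
    (m : ℕ) (hm : 1 < m)
    (P : 𝒳 → 𝒳 → ℝ)
    (hPnn : ∀ x y, 0 ≤ P y x)
    (hcol : ∀ x, ∑ y, P y x = 1)
    (hrow : ∀ y, ∑ x, P y x = 1)
    (N : 𝒳 → 𝒳 → ℕ)
    (hN : ∀ x y, (N y x : ℝ) = m * P y x) :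
    (∀ p : 𝒳 × Fin m, ∃! q : 𝒳 × Fin m,
      ∃ i : ℕ, i < N q.1 p.1 ∧
        (p.2 : ℕ) = i + ∑ z ∈ univ.filter (· < q.1), N z p.1 ∧
        (q.2 : ℕ) = i + ∑ z ∈ univ.filter (· < p.1), N q.1 z) ∧
    (∃ T : (𝒳 × Fin m) ≃ (𝒳 × Fin m), ∀ p q : 𝒳 × Fin m,
      (∃ i : ℕ, i < N q.1 p.1 ∧
        (p.2 : ℕ) = i + ∑ z ∈ univ.filter (· < q.1), N z p.1 ∧
        (q.2 : ℕ) = i + ∑ z ∈ univ.filter (· < p.1), N q.1 z) ↔ T p = q) := by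
  have hcolN : ∀ x, ∑ y, N y x = m := fun x => by
    have : (∑ y, (N y x : ℝ)) = m := by simp_rw [hN, ← mul_sum, hcol, mul_one]
    exact_mod_cast this
  have hrowN : ∀ y, ∑ x, N y x = m := fun y => by
    have : (∑ x, (N y x : ℝ)) = m := by simp_rw [hN, ← mul_sum, hrow, mul_one]
    exact_mod_cast this
  refine ⟨existsUnique_multibaker_image N hcolN hrowN,
    exists_equiv_of_existsUnique (existsUnique_multibaker_image N hcolN hrowN) fun q => ?_⟩
  have h := existsUnique_multibaker_image (fun x y => N y x) hrowN hcolN q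
  simpa only [and_comm (a := (q.2 : ℕ) = _)] using h
end

section
/- Let m > 1 be an integer, 𝒳 a finite linearly ordered set, and P : 𝒳 × 𝒳 → ℝ a doubly stochastic matrix with m·P(y,x) ∈ ℕ for all x, y. Let T : 𝒳 × ℤ_m → 𝒳 × ℤ_m be the bijection defined by T( x, i + m·∑_{z<y} P(z,x) ) := ( y, i + m·∑_{z<x} P(y,z) ) for 0 ≤ i < m·P(y,x). Fix x ∈ 𝒳 and let R be a uniformly distributed random variable on ℤ_m. Then for every y ∈ 𝒳, the probability that the first component of T(x, R) equals y is exactly P(y,x). -/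
open Finset

/-- Partial sums over a strict initial segment, together with the next term, are bounded by the
full sum. -/
theorem add_sum_filter_lt_le_sum {α : Type*} [Fintype α] [LinearOrder α] (f : α → ℕ) (a : α) :
    f a + ∑ z ∈ univ.filter (· < a), f z ≤ ∑ z, f z := by
  rw [← sum_insert (by simp)]
  exact sum_le_sum_of_subset (subset_univ _)

/-- Let `m > 1`, `𝒳` a finite linearly ordered set, `P` a doubly
stochastic matrix with `m·P(y,x) = N(y,x) ∈ ℕ`, and `T` the multibaker bijection of
`𝒳 × ℤ_m`, characterized by `T( x, i + m·∑_{z<y} P(z,x) ) = ( y, i + m·∑_{z<x} P(y,z) )`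
for `0 ≤ i < m·P(y,x)`. Fix `x ∈ 𝒳` and let `R` be uniformly distributed on `ℤ_m`. Then
for every `y ∈ 𝒳`, the probability that the first component of `T(x, R)` equals `y` is
exactly `P(y,x)`. -/
theorem multibaker_transition_probability
    {𝒳 : Type*} [Fintype 𝒳] [LinearOrder 𝒳]
    (m : ℕ) (hm : 1 < m)
    (P : 𝒳 → 𝒳 → ℝ)
    (hPnn : ∀ x y, 0 ≤ P y x)
    (hcol : ∀ x, ∑ y, P y x = 1)
    (hrow : ∀ y, ∑ x, P y x = 1)
    (N : 𝒳 → 𝒳 → ℕ)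
    (hN : ∀ x y, (N y x : ℝ) = m * P y x)
    (T : (𝒳 × Fin m) ≃ (𝒳 × Fin m))
    (hT : ∀ p q : 𝒳 × Fin m,
      (∃ i : ℕ, i < N q.1 p.1 ∧
        (p.2 : ℕ) = i + ∑ z ∈ univ.filter (· < q.1), N z p.1 ∧
        (q.2 : ℕ) = i + ∑ z ∈ univ.filter (· < p.1), N q.1 z) ↔ T p = q)
    (x y : 𝒳) :
    ((univ.filter fun r : Fin m => (T (x, r)).1 = y).card : ℝ) / m = P y x := by
  have hm0 : (m : ℝ) ≠ 0 := by positivity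
  have hcolN : ∑ z, N z x = m := by
    have h : ((∑ z, N z x : ℕ) : ℝ) = m := by
      push_cast
      simp_rw [hN, ← mul_sum, hcol, mul_one]
    exact_mod_cast h
  have hrowN : ∑ z, N y z = m := by
    have h : ((∑ z, N y z : ℕ) : ℝ) = m := by
      push_cast
      simp_rw [hN, ← mul_sum, hrow, mul_one]
    exact_mod_cast h
  have hc := add_sum_filter_lt_le_sum (fun z => N z x) y
  have hr := add_sum_filter_lt_le_sum (fun z => N y z) x
  rw [hcolN] at hc
  rw [hrowN] at hr
  have himage : (univ.filter fun r : Fin m => (T (x, r)).1 = y).map Fin.valEmbedding =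
      Ico (∑ z ∈ univ.filter (· < y), N z x) (∑ z ∈ univ.filter (· < y), N z x + N y x) := by
    ext k
    simp only [mem_map, mem_filter, mem_univ, true_and, Fin.valEmbedding_apply, mem_Ico]
    constructor
    · rintro ⟨r, rfl, rfl⟩
      obtain ⟨i, hi, hp, -⟩ := (hT (x, r) (T (x, r))).2 rfl
      dsimp only at hi hp
      omega
    · rintro ⟨h₁, h₂⟩
      refine ⟨⟨k, by omega⟩, ?_, rfl⟩
      have hq := (hT (x, ⟨k, by omega⟩)
        (y, ⟨k - ∑ z ∈ univ.filter (· < y), N z x + ∑ z ∈ univ.filter (· < x), N y z,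
          by omega⟩)).1 ⟨k - ∑ z ∈ univ.filter (· < y), N z x, by dsimp only; omega,
            by dsimp only; omega, rfl⟩
      rw [hq]
  have hcard : (univ.filter fun r : Fin m => (T (x, r)).1 = y).card = N y x := by
    rw [← card_map Fin.valEmbedding, himage, Nat.card_Ico, Nat.add_sub_cancel_left]
  rw [hcard, hN, mul_div_cancel_left₀ _ hm0]
end

section
/- Let m > 1 be an integer, 𝒳 a finite linearly ordered set, and P : 𝒳 × 𝒳 → ℝ a doubly stochastic matrix with m·P(y,x) ∈ ℕ for all x, y, and let T : 𝒳 × ℤ_m → 𝒳 × ℤ_m be the associated multibaker bijection. Define the multibaker map Φ on 𝒳 × (ℤ_m)^ℤ as follows: writing a state as (x, r) with r : ℤ → ℤ_m, first shift r, then apply T to the pair (x, r(0)); explicitly, if T(x, r(0)) = (x', r₀'), then Φ(x, r) := (x', s) where s(−1) := r₀', s(−k) := r(−(k−1)) for k ≥ 2, and s(j) := r(j+1) for j ≥ 0. Suppose the initial state (X₀, R) is random, where the coordinates (R(i))_{i∈ℤ} are independent and uniformly distributed on ℤ_m and independent of X₀. Let X_t denote the first coordinate of the t-fold iterate Φ^t(X₀,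 R). Then (X_t)_{t∈ℕ} is a time-homogeneous Markov chain with transition matrix P: for all t ≥ 0 and all x₀, …, x_{t+1} ∈ 𝒳 with Pr(X₀ = x₀, …, X_t = x_t) > 0, Pr( X_{t+1} = x_{t+1} | X₀ = x₀, …, X_t = x_t ) = P(x_{t+1}, x_t). -/
open Finset MeasureTheory

/-- Independent uniform digits: the joint law of an initial state, membership constraints on the
digits `0, …, a - 1`, and fixed values of finitely many later digits. -/
lemma measure_digits_mem_and_eq {𝒳 Ω : Type*} [MeasurableSpace Ω] {ℙ : Measure Ω} {m : ℕ}
    {X₀ : Ω → 𝒳} {R : Ω → ℤ → Fin m}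
    (hX₀meas : ∀ x : 𝒳, MeasurableSet {ω | X₀ ω = x})
    (hRmeas : ∀ (i : ℤ) (v : Fin m), MeasurableSet {ω | R ω i = v})
    (hIndep : ∀ (x : 𝒳) (s : Finset ℤ) (v : ℤ → Fin m),
      ℙ {ω | X₀ ω = x ∧ ∀ i ∈ s, R ω i = v i} =
        ℙ {ω | X₀ ω = x} * (m : ENNReal)⁻¹ ^ s.card)
    (x : 𝒳) (A : ℕ → Finset (Fin m)) (a : ℕ) (s : Finset ℤ) (hs : ∀ i ∈ s, (a : ℤ) ≤ i)
    (v : ℤ → Fin m) :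
    ℙ {ω | X₀ ω = x ∧ (∀ k < a, R ω k ∈ A k) ∧ ∀ i ∈ s, R ω i = v i} =
      ℙ {ω | X₀ ω = x} * (∏ k ∈ range a, ((A k).card * (m : ENNReal)⁻¹)) *
        (m : ENNReal)⁻¹ ^ s.card := by
  induction a generalizing s v with
  | zero => simpa using hIndep x s v
  | succ a ih =>
    have hnot : (a : ℤ) ∉ s := fun h => by have := hs _ h; push_cast at this; omega
    have hmem : ∀ (k : ℤ) (B : Finset (Fin m)), MeasurableSet {ω | R ω k ∈ B} := by
      intro k B
      have : {ω | R ω k ∈ B} = ⋃ w ∈ B, {ω | R ω k = w} := by ext; simp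
      rw [this]
      exact B.measurableSet_biUnion fun w _ => hRmeas k w
    have hsplit : {ω | X₀ ω = x ∧ (∀ k < a + 1, R ω k ∈ A k) ∧ ∀ i ∈ s, R ω i = v i} =
        ⋃ w ∈ A a, {ω | X₀ ω = x ∧ (∀ k < a, R ω k ∈ A k) ∧
          ∀ i ∈ insert (a : ℤ) s, R ω i = Function.update v a w i} := by
      ext ω
      have hupd : ∀ w, (∀ i ∈ s, R ω i = Function.update v (a : ℤ) w i) ↔
          ∀ i ∈ s, R ω i = v i := fun w => forall₂_congr fun i hi => by
        rw [Function.update_of_ne fun h : i = a => hnot (h ▸ hi)]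
      simp only [Set.mem_ofPred_eq, Set.mem_iUnion, forall_mem_insert, Function.update_self, hupd,
        Nat.forall_lt_succ_right, exists_prop]
      grind
    rw [hsplit, measure_biUnion_finset]
    · rw [sum_congr rfl fun w _ => ih (insert (a : ℤ) s) ?_ (Function.update v a w)]
      · rw [sum_const, card_insert_of_notMem hnot, prod_range_succ, nsmul_eq_mul, pow_succ]
        ring
      · intro i hi
        rcases mem_insert.1 hi with rfl | hi
        · rfl
        · have := hs i hi
          push_cast at this
          omega
    · intro w _ w' _ hww
      refine Set.disjoint_left.2 fun ω h h' => hww ?_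
      have h1 := h.2.2 a (mem_insert_self _ _)
      have h2 := h'.2.2 a (mem_insert_self _ _)
      simp only [Function.update_self] at h1 h2
      rw [← h1, h2]
    · intro w _
      simp only [Set.ofPred_and, Set.ofPred_forall]
      exact (hX₀meas x).inter ((MeasurableSet.iInter fun k : ℕ => MeasurableSet.iInter fun _ =>
        hmem k (A k)).inter (Finset.measurableSet_biInter _ fun i _ => hRmeas i _))

/-- A multibaker bijection sends exactly `N y x` of the points in the cell `x` to the cell `y`. -/
lemma card_multibaker_fst_eq {𝒳 : Type*} [Fintype 𝒳] [LinearOrder 𝒳] {m : ℕ} {N : 𝒳 → 𝒳 → ℕ}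
    (hcol : ∀ x, ∑ y, N y x = m) (hrow : ∀ y, ∑ x, N y x = m)
    {T : (𝒳 × Fin m) ≃ (𝒳 × Fin m)}
    (hT : ∀ p q : 𝒳 × Fin m,
      (∃ i : ℕ, i < N q.1 p.1 ∧
        (p.2 : ℕ) = i + ∑ z ∈ univ.filter (· < q.1), N z p.1 ∧
        (q.2 : ℕ) = i + ∑ z ∈ univ.filter (· < p.1), N q.1 z) ↔ T p = q)
    (x y : 𝒳) :
    (univ.filter fun v : Fin m => (T (x, v)).1 = y).card = N y x := by
  have hle : ∀ (f : 𝒳 → ℕ) (b : 𝒳), f b + ∑ z ∈ univ.filter (· < b), f z ≤ ∑ z, f z := by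
    intro f b
    rw [← sum_insert (by simp)]
    exact sum_le_sum_of_subset (subset_univ _)
  have h₁ := (hle (fun z => N z x) y).trans_eq (hcol x)
  have h₂ := (hle (fun z => N y z) x).trans_eq (hrow y)
  rw [← card_range (N y x)]
  symm
  refine card_bij (fun i hi => ⟨i + ∑ z ∈ univ.filter (· < y), N z x, ?_⟩) ?_ ?_ ?_
  · have := mem_range.1 hi
    omega
  · intro i hi
    have hi := mem_range.1 hi
    rw [mem_filter]
    refine ⟨mem_univ _, ?_⟩
    rw [(hT _ (y, ⟨i + ∑ z ∈ univ.filter (· < x), N y z, by omega⟩)).1 ⟨i, hi, rfl, rfl⟩]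
  · intro i _ j _ hij
    simpa using hij
  · intro v hv
    obtain ⟨i, hi, hp, -⟩ := (hT (x, v) _).2 rfl
    rw [(mem_filter.1 hv).2] at hi hp
    exact ⟨i, mem_range.2 hi, Fin.ext hp.symm⟩

/-- Iterating the multibaker map shifts the digits of nonnegative index. -/
lemma multibaker_iterate_snd {𝒳 : Type*} {m : ℕ} {T : (𝒳 × Fin m) ≃ (𝒳 × Fin m)}
    {Φ : 𝒳 × (ℤ → Fin m) → 𝒳 × (ℤ → Fin m)}
    (hΦ : ∀ (x : 𝒳) (r : ℤ → Fin m),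
      Φ (x, r) = ((T (x, r 0)).1,
        Function.update (fun j : ℤ => r (j + 1)) (-1) (T (x, r 0)).2))
    (p : 𝒳 × (ℤ → Fin m)) (k : ℕ) (j : ℤ) (hj : 0 ≤ j) :
    (Φ^[k] p).2 j = p.2 (j + k) := by
  induction k generalizing j with
  | zero => simp
  | succ k ih =>
    rw [Function.iterate_succ_apply', ← Prod.mk.eta (p := Φ^[k] p), hΦ]
    simp only
    rw [Function.update_of_ne (by omega), ih _ (by omega)]
    exact congrArg p.2 (by push_cast; ring)

/-- Let `m > 1`, `𝒳` a finite linearly ordered set, `P` a doubly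
stochastic matrix with `m·P(y,x) = N(y,x) ∈ ℕ`, and `T` the associated multibaker bijection
of `𝒳 × ℤ_m`. Define the multibaker map `Φ` on `𝒳 × (ℤ_m)^ℤ` by: writing a state as
`(x, r)`, if `T(x, r(0)) = (x', r₀')` then `Φ(x, r) = (x', s)` where `s(−1) = r₀'` and
`s(j) = r(j+1)` for all `j ≠ −1` (i.e. `s(−k) = r(−(k−1))` for `k ≥ 2` and `s(j) = r(j+1)`
for `j ≥ 0`). Let the initial state `(X₀, R)` be random, with the coordinates `(R(i))_{i∈ℤ}`
independent, uniform on `ℤ_m`, and independent of `X₀` (hypothesis `hIndep` gives all the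
finite-dimensional joint distributions). Let `Xt t ω` be the first coordinate of
`Φ^[t] (X₀ ω, R ω)`. Then `(Xt t)` is a time-homogeneous Markov chain with transition
matrix `P`: whenever `Pr(X₀ = xs 0, …, X_t = xs t) > 0`,
`Pr( X_{t+1} = xs (t+1) | X₀ = xs 0, …, X_t = xs t ) = P(xs (t+1), xs t)`. -/
theorem multibaker_coarse_graining_is_markov
    {𝒳 Ω : Type*} [Fintype 𝒳] [LinearOrder 𝒳]
    (m : ℕ) (hm : 1 < m)
    (P : 𝒳 → 𝒳 → ℝ)
    (hPnn : ∀ x y, 0 ≤ P y x)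
    (hcol : ∀ x, ∑ y, P y x = 1)
    (hrow : ∀ y, ∑ x, P y x = 1)
    (N : 𝒳 → 𝒳 → ℕ)
    (hN : ∀ x y, (N y x : ℝ) = m * P y x)
    (T : (𝒳 × Fin m) ≃ (𝒳 × Fin m))
    (hT : ∀ p q : 𝒳 × Fin m,
      (∃ i : ℕ, i < N q.1 p.1 ∧
        (p.2 : ℕ) = i + ∑ z ∈ univ.filter (· < q.1), N z p.1 ∧
        (q.2 : ℕ) = i + ∑ z ∈ univ.filter (· < p.1), N q.1 z) ↔ T p = q)
    [MeasurableSpace Ω] (ℙ : Measure Ω) [IsProbabilityMeasure ℙ]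
    (X₀ : Ω → 𝒳) (R : Ω → ℤ → Fin m)
    (hX₀meas : ∀ x : 𝒳, MeasurableSet {ω | X₀ ω = x})
    (hRmeas : ∀ (i : ℤ) (v : Fin m), MeasurableSet {ω | R ω i = v})
    (hIndep : ∀ (x : 𝒳) (s : Finset ℤ) (v : ℤ → Fin m),
      ℙ {ω | X₀ ω = x ∧ ∀ i ∈ s, R ω i = v i} =
        ℙ {ω | X₀ ω = x} * (m : ENNReal)⁻¹ ^ s.card)
    (Φ : 𝒳 × (ℤ → Fin m) → 𝒳 × (ℤ → Fin m))
    (hΦ : ∀ (x : 𝒳) (r : ℤ → Fin m),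
      Φ (x, r) = ((T (x, r 0)).1,
        Function.update (fun j : ℤ => r (j + 1)) (-1) (T (x, r 0)).2))
    (Xt : ℕ → Ω → 𝒳)
    (hXt : ∀ (t : ℕ) (ω : Ω), Xt t ω = (Φ^[t] (X₀ ω, R ω)).1) :
    ∀ (t : ℕ) (xs : ℕ → 𝒳),
      ℙ {ω | ∀ k ≤ t, Xt k ω = xs k} ≠ 0 →
      ℙ {ω | ∀ k ≤ t + 1, Xt k ω = xs k} / ℙ {ω | ∀ k ≤ t, Xt k ω = xs k} =
        ENNReal.ofReal (P (xs (t + 1)) (xs t)) := by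
  intro t xs hne
  have hm0 : (m : ℝ) ≠ 0 := by positivity
  have hcolN : ∀ x, ∑ y, N y x = m := fun x => by
    have : (∑ y, (N y x : ℝ)) = m := by simp only [hN, ← mul_sum, hcol, mul_one]
    exact_mod_cast this
  have hrowN : ∀ y, ∑ x, N y x = m := fun y => by
    have : (∑ x, (N y x : ℝ)) = m := by simp only [hN, ← mul_sum, hrow, mul_one]
    exact_mod_cast this
  have hstep : ∀ k ω, Xt (k + 1) ω = (T (Xt k ω, R ω k)).1 := fun k ω => by
    rw [hXt, hXt, Function.iterate_succ_apply', ← Prod.mk.eta (p := Φ^[k] (X₀ ω, R ω)), hΦ,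
      multibaker_iterate_snd hΦ _ k 0 le_rfl, zero_add]
  set A : ℕ → Finset (Fin m) := fun k => univ.filter fun v => (T (xs k, v)).1 = xs (k + 1)
  have hevent : ∀ n ω, (∀ k ≤ n, Xt k ω = xs k) ↔ X₀ ω = xs 0 ∧ ∀ k < n, R ω k ∈ A k := by
    intro n ω
    induction n with
    | zero => simp [hXt]
    | succ n ih =>
      rw [Nat.forall_lt_succ_right, ← and_assoc, ← ih]
      simp only [← Nat.lt_succ_iff]
      rw [Nat.forall_lt_succ_right]
      refine and_congr_right fun h => ?_
      rw [hstep, h n (Nat.lt_succ_self n)]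
      simp [A]
  have hprob : ∀ n, ℙ {ω | ∀ k ≤ n, Xt k ω = xs k} =
      ℙ {ω | X₀ ω = xs 0} * ∏ k ∈ range n, ((A k).card * (m : ENNReal)⁻¹) := fun n => by
    simpa [hevent] using measure_digits_mem_and_eq hX₀meas hRmeas hIndep (xs 0) A n ∅ (by simp)
      (fun _ => ⟨0, by omega⟩)
  have hcard : ((A t).card : ENNReal) * (m : ENNReal)⁻¹ =
      ENNReal.ofReal (P (xs (t + 1)) (xs t)) := by
    rw [card_multibaker_fst_eq hcolN hrowN hT, ← div_eq_mul_inv, ← ENNReal.ofReal_natCast,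
      ← ENNReal.ofReal_natCast m, ← ENNReal.ofReal_div_of_pos (by positivity), hN,
      mul_div_cancel_left₀ _ hm0]
  rw [hprob (t + 1), prod_range_succ, ← mul_assoc, ← hprob t, hcard]
  rw [mul_comm, ENNReal.mul_div_cancel_right hne (measure_ne_top _ _)]
end
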